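/- arXiv:1406.4810 — 2 statements merged into one kernel-verified Lean document; each statement's English description precedes it below -/
import Mathlib

section
/- For each k ∈ ℤ₊ let N_k ∈ ℤ₊ and let b_k(1),…,b_k(N_k) and d_k(1),…,d_k(N_k) be positive real numbers such that: (i) there is k₀ with ∑_{n=1}^{N_k} b_k(n) < 1 for all k ≥ k₀ and there is k₁ with ∑_{n=1}^{N_k} d_k(n) < 1 for all k ≥ k₁; (ii) max_{n=1,…,N_k} b_k(n) → 0 and max_{n=1,…,N_k} d_k(n) → 0 as k → ∞. Let s_k be the unique solution of ∑_{n=1}^{N_k} (b_k(n))^{s_k} = 1 and let δ_k be the unique solution of ∑_{n=1}^{N_k} (d_k(n))^{δ_k} = 1. If there exists C ≥ 1 such that C^{-1} ≤ b_k(n)/d_k(n) ≤ C for all k ∈ ℤ₊ and all n ∈ {1,…,N_k}, then liminf_{k→∞} s_k = liminf_{k→∞} δ_k and limsup_{k→∞} s_k = limsup_{k→∞} δ_k. -/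
open Filter

/-- A family of numbers in `(0, 1)` with sum less than one has Moran exponent at most one. -/
theorem moran_exponent_le_one {ι : Type*} [Fintype ι] {a : ι → ℝ} {t : ℝ}
    (ha : ∀ n, 0 < a n) (ha1 : ∀ n, a n < 1) (hsum : ∑ n, a n < 1)
    (ht : ∑ n, a n ^ t = 1) : t ≤ 1 := by
  by_contra! h
  have hle : ∑ n, a n ^ t ≤ ∑ n, a n := Finset.sum_le_sum fun n _ ↦ by
    simpa using Real.rpow_le_rpow_of_exponent_ge (ha n) (ha1 n).le h.le
  linarith

/-- If `a ≤ C * c` entrywise and the entries of `c` are small in terms of `C` and `ε`, then the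
Moran exponent of `a` exceeds that of `c` by at most `ε`. -/
theorem moran_exponent_le_add {ι : Type*} [Fintype ι] {a c : ι → ℝ} {t u C ε : ℝ}
    (ha : ∀ n, 0 < a n) (ha1 : ∀ n, a n < 1) (hc : ∀ n, 0 < c n) (hC : 1 ≤ C)
    (hac : ∀ n, a n ≤ C * c n) (hε : 0 < ε)
    (hsmall : ∀ n, c n < (C ^ (1 + ε)) ^ (-ε⁻¹)) (hu0 : 0 ≤ u) (hu1 : u ≤ 1)
    (ht : ∑ n, a n ^ t = 1) (hu : ∑ n, c n ^ u = 1) : t ≤ u + ε := by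
  by_contra! h
  have hC0 : 0 < C := by linarith
  have hne : (Finset.univ : Finset ι).Nonempty := by
    by_contra hempty
    simp [Finset.not_nonempty_iff_eq_empty.mp hempty] at hu
  have hlt : ∑ n, a n ^ t < ∑ n, a n ^ (u + ε) := Finset.sum_lt_sum_of_nonempty hne fun n _ ↦
    Real.rpow_lt_rpow_of_exponent_gt (ha n) (ha1 n) h
  have hle : ∑ n, a n ^ (u + ε) ≤ ∑ n, c n ^ u := Finset.sum_le_sum fun n _ ↦ by
    have hcε : c n ^ ε ≤ (C ^ (1 + ε))⁻¹ := by
      calc c n ^ ε ≤ ((C ^ (1 + ε)) ^ (-ε⁻¹)) ^ ε :=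
            Real.rpow_le_rpow (hc n).le (hsmall n).le hε.le
        _ = (C ^ (1 + ε))⁻¹ := by
            rw [← Real.rpow_mul (by positivity), neg_mul, inv_mul_cancel₀ hε.ne',
              Real.rpow_neg_one]
    have hcu : 0 < c n ^ u := Real.rpow_pos_of_pos (hc n) u
    calc a n ^ (u + ε) ≤ (C * c n) ^ (u + ε) :=
          Real.rpow_le_rpow (ha n).le (hac n) (by linarith)
      _ = C ^ (u + ε) * (c n ^ u * c n ^ ε) := by
          rw [Real.mul_rpow hC0.le (hc n).le, Real.rpow_add (hc n)]
      _ ≤ C ^ (1 + ε) * (c n ^ u * (C ^ (1 + ε))⁻¹) := by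
          have := Real.rpow_le_rpow_of_exponent_le hC (show u + ε ≤ 1 + ε by linarith)
          have := Real.rpow_pos_of_pos (hc n) ε
          gcongr
      _ = c n ^ u := by
          have : 0 < C ^ (1 + ε) := by positivity
          field_simp
  linarith

/-- If `u` and `v` are nonnegative, `v` is eventually at most one, and `u ≤ v + ε` eventually for
every `ε > 0`, then the lower and upper limits of `u` are at most those of `v`. -/
theorem liminf_le_and_limsup_le_of_eventually_le_add {u v : ℕ → ℝ}
    (hu : ∀ k, 0 ≤ u k) (hv : ∀ k, 0 ≤ v k)
    (hv1 : ∀ᶠ k in atTop, v k ≤ 1)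
    (h : ∀ ε > 0, ∀ᶠ k in atTop, u k ≤ v k + ε) :
    liminf u atTop ≤ liminf v atTop ∧ limsup u atTop ≤ limsup v atTop := by
  have hub : IsBoundedUnder (· ≥ ·) atTop u := isBoundedUnder_of ⟨0, hu⟩
  have hvb : IsBoundedUnder (· ≥ ·) atTop v := isBoundedUnder_of ⟨0, hv⟩
  have hva : IsBoundedUnder (· ≤ ·) atTop v := isBoundedUnder_of_eventually_le hv1
  constructor <;> refine le_of_forall_pos_le_add fun ε hε ↦ ?_
  · rw [← liminf_add_const atTop v ε hva.isCoboundedUnder_ge hvb]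
    refine liminf_le_liminf (h ε hε) hub (IsBoundedUnder.isCoboundedUnder_ge ?_)
    exact isBoundedUnder_of_eventually_le (a := 1 + ε) (hv1.mono fun k hk ↦ by linarith)
  · rw [← limsup_add_const atTop v ε hva hvb.isCoboundedUnder_le]
    refine limsup_le_limsup (h ε hε) hub.isCoboundedUnder_le ?_
    exact isBoundedUnder_of_eventually_le (a := 1 + ε) (hv1.mono fun k hk ↦ by linarith)

/-- If two Moran-type families of positive numbers have uniformly comparable
entries, then the associated pre-dimensions (liminf and limsup of the Moran
exponents) coincide. -/
theorem moran_predimensions_eq_of_bounded_ratio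
    (N : ℕ → ℕ) (hN : ∀ k, 0 < N k)
    (b d : (k : ℕ) → Fin (N k) → ℝ)
    (hb : ∀ k n, 0 < b k n) (hd : ∀ k n, 0 < d k n)
    (k₀ : ℕ) (hbsum : ∀ k, k₀ ≤ k → ∑ n, b k n < 1)
    (k₁ : ℕ) (hdsum : ∀ k, k₁ ≤ k → ∑ n, d k n < 1)
    (hbmax : ∀ ε > (0:ℝ), ∀ᶠ k in atTop, ∀ n, b k n < ε)
    (hdmax : ∀ ε > (0:ℝ), ∀ᶠ k in atTop, ∀ n, d k n < ε)
    (s δ : ℕ → ℝ)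
    (hs : ∀ k, 0 ≤ s k ∧ ∑ n, (b k n) ^ (s k) = 1)
    (hδ : ∀ k, 0 ≤ δ k ∧ ∑ n, (d k n) ^ (δ k) = 1)
    (C : ℝ) (hC : 1 ≤ C)
    (hratio : ∀ k n, C⁻¹ ≤ b k n / d k n ∧ b k n / d k n ≤ C) :
    liminf s atTop = liminf δ atTop ∧ limsup s atTop = limsup δ atTop := by
  have hs1 : ∀ᶠ k in atTop, s k ≤ 1 := by
    filter_upwards [hbmax 1 one_pos, eventually_ge_atTop k₀] with k hk hk₀
    exact moran_exponent_le_one (hb k) hk (hbsum k hk₀) (hs k).2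
  have hδ1 : ∀ᶠ k in atTop, δ k ≤ 1 := by
    filter_upwards [hdmax 1 one_pos, eventually_ge_atTop k₁] with k hk hk₁
    exact moran_exponent_le_one (hd k) hk (hdsum k hk₁) (hδ k).2
  have hC0 : 0 < C := by linarith
  have hbd : ∀ k n, b k n ≤ C * d k n := fun k n ↦ (div_le_iff₀ (hd k n)).mp (hratio k n).2
  have hdb : ∀ k n, d k n ≤ C * b k n := fun k n ↦
    (inv_mul_le_iff₀ hC0).mp ((le_div_iff₀ (hd k n)).mp (hratio k n).1)
  have hsδ := liminf_le_and_limsup_le_of_eventually_le_add (fun k ↦ (hs k).1) (fun k ↦ (hδ k).1)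
    hδ1 fun ε hε ↦ by
      filter_upwards [hbmax 1 one_pos, hdmax ((C ^ (1 + ε)) ^ (-ε⁻¹)) (by positivity), hδ1]
        with k hbk hdk hδk
      exact moran_exponent_le_add (hb k) hbk (hd k) hC (hbd k) hε hdk (hδ k).1 hδk
        (hs k).2 (hδ k).2
  have hδs := liminf_le_and_limsup_le_of_eventually_le_add (fun k ↦ (hδ k).1) (fun k ↦ (hs k).1)
    hs1 fun ε hε ↦ by
      filter_upwards [hdmax 1 one_pos, hbmax ((C ^ (1 + ε)) ^ (-ε⁻¹)) (by positivity), hs1]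
        with k hdk hbk hsk
      exact moran_exponent_le_add (hd k) hdk (hb k) hC (hdb k) hε hbk (hs k).1 hsk
        (hδ k).2 (hs k).2
  exact ⟨le_antisymm hsδ.1 hδs.1, le_antisymm hsδ.2 hδs.2⟩
end

section
/- For n ∈ ℤ₊ let M(n) be the 3×3 integer matrix with rows (0, 1, 0), (n+1, 0, n), (n, 0, n−1). Then for every k ≥ 5 and all a₁, …, a_k ∈ ℤ₊, every entry of the product M(a₁)·M(a₂)·…·M(a_k) is strictly positive. -/
/-- The transition matrix governing the combinatorics of the spectral
generating bands: row/column indices `0, 1, 2` correspond to the band types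
`I, II, III`. -/
def bandMatrix (n : ℕ) : Matrix (Fin 3) (Fin 3) ℤ :=
  !![0, 1, 0; (n : ℤ) + 1, 0, (n : ℤ); (n : ℤ), 0, (n : ℤ) - 1]

theorem bandMatrix_one_le {n : ℕ} (hn : 1 ≤ n) (i j : Fin 3) :
    bandMatrix 1 i j ≤ bandMatrix n i j := by
  fin_cases i <;> fin_cases j <;> simp [bandMatrix] <;> omega

theorem bandMatrix_one_nonneg (i j : Fin 3) : 0 ≤ bandMatrix 1 i j := by
  fin_cases i <;> fin_cases j <;> simp [bandMatrix]

theorem bandMatrix_one_pow_nonneg (k : ℕ) (i j : Fin 3) : 0 ≤ (bandMatrix 1 ^ k) i j := by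
  induction k generalizing i with
  | zero => rw [pow_zero, Matrix.one_apply]; split_ifs <;> simp
  | succ k ih =>
    rw [pow_succ', Matrix.mul_apply]
    exact Finset.sum_nonneg fun m _ => mul_nonneg (bandMatrix_one_nonneg i m) (ih m)

/-- The matrix `bandMatrix 1` is primitive, with exponent at most `5`. -/
theorem bandMatrix_one_pow_pos {k : ℕ} (hk : 5 ≤ k) (i j : Fin 3) :
    0 < (bandMatrix 1 ^ k) i j := by
  induction k, hk using Nat.le_induction generalizing i with
  | base => revert i j; decide
  | succ k _ ih =>
    have h0 := ih 0
    have h1 := ih 1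
    have h2 := ih 2
    rw [pow_succ', Matrix.mul_apply, Fin.sum_univ_three]
    fin_cases i <;> simp [bandMatrix] at * <;> linarith

theorem bandMatrix_one_pow_le_prod (l : List ℕ) (hl : ∀ n ∈ l, 1 ≤ n) (i j : Fin 3) :
    (bandMatrix 1 ^ l.length) i j ≤ (l.map bandMatrix).prod i j := by
  induction l generalizing i with
  | nil => simp
  | cons n l ih =>
    rw [List.length_cons, List.map_cons, List.prod_cons, pow_succ', Matrix.mul_apply,
      Matrix.mul_apply]
    have hn := bandMatrix_one_le (hl n List.mem_cons_self) i
    exact Finset.sum_le_sum fun m _ => mul_le_mul (hn m)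
      (ih (fun x hx => hl x (List.mem_cons_of_mem n hx)) m)
      (bandMatrix_one_pow_nonneg _ m j) ((bandMatrix_one_nonneg i m).trans (hn m))

/-- Every entry of a product of at least five band transition matrices (with
positive integer parameters) is strictly positive. -/
theorem bandMatrix_list_prod_pos (k : ℕ) (hk : 5 ≤ k)
    (a : Fin k → ℕ) (ha : ∀ i, 1 ≤ a i) :
    ∀ i j : Fin 3, 0 < (List.ofFn fun i => bandMatrix (a i)).prod i j := by
  intro i j
  have h := bandMatrix_one_pow_le_prod (List.ofFn a) (by simpa [List.mem_ofFn] using ha) i j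
  rw [List.length_ofFn, List.map_ofFn] at h
  exact (bandMatrix_one_pow_pos hk i j).trans_le h
end
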